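/- arXiv:1507.01215 — 2 statements merged into one kernel-verified Lean document; each statement's English description precedes it below -/
import Mathlib

section
/- If a class C of r.e. sets is BC* learnable, then C is weakly approximately (WeakApprox) learnable. -/
open Filter

/-- The `e`-th partial recursive function in a fixed acceptable numbering. -/
def phi (e : ℕ) : ℕ →. ℕ := Nat.Partrec.Code.eval (Denumerable.ofNat Nat.Partrec.Code e)

/-- The `e`-th recursively enumerable set, `W_e = dom(φ_e)`. -/
def Wset (e : ℕ) : Set ℕ := (phi e).Dom

/-- `T` is a text for `L`: the natural numbers occurring in `T` are exactly
the members of `L` (`none` plays the role of the pause symbol `#`). -/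
def IsText (T : ℕ → Option ℕ) (L : Set ℕ) : Prop :=
  {x : ℕ | ∃ n, T n = some x} = L

/-- The finite sequence `T[n] = T(0), ..., T(n-1)`. -/
def pref (T : ℕ → Option ℕ) (n : ℕ) : List (Option ℕ) :=
  (List.range n).map T

/-- `M` partially (Part) learns `C`: on every text for every `L ∈ C` there is
exactly one index output infinitely often, and that index is an index of `L`. -/
def PartLearns (M : List (Option ℕ) → ℕ) (C : Set (Set ℕ)) : Prop :=
  ∀ L ∈ C, ∀ T : ℕ → Option ℕ, IsText T L →
    ∃ e, {n | M (pref T n) = e}.Infinite ∧ Wset e = L ∧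
      ∀ d, {n | M (pref T n) = d}.Infinite → d = e

/-- `M` is consistent (Cons): every number occurring in `σ` belongs to `W_{M(σ)}`. -/
def ConsLearner (M : List (Option ℕ) → ℕ) : Prop :=
  ∀ σ : List (Option ℕ), ∀ x : ℕ, some x ∈ σ → x ∈ Wset (M σ)

/-- `M` finitely approximately (FinApprox) learns `C`. -/
def FinApproxLearns (M : List (Option ℕ) → ℕ) (C : Set (Set ℕ)) : Prop :=
  ∀ L ∈ C, ∀ T : ℕ → Option ℕ, IsText T L → ∀ D : Finset ℕ,
    ∀ᶠ n in atTop, Wset (M (pref T n)) ∩ ↑D = L ∩ ↑D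

/-- `M` BC*-learns `C`: almost all hypotheses are finite variants of the target. -/
def BCstarLearns (M : List (Option ℕ) → ℕ) (C : Set (Set ℕ)) : Prop :=
  ∀ L ∈ C, ∀ T : ℕ → Option ℕ, IsText T L →
    ∀ᶠ n in atTop, (symmDiff (Wset (M (pref T n))) L).Finite

/-- `M` BC^k-learns `C`: almost all hypotheses differ from the target in at
most `k` elements. -/
def BCnLearns (k : ℕ) (M : List (Option ℕ) → ℕ) (C : Set (Set ℕ)) : Prop :=
  ∀ L ∈ C, ∀ T : ℕ → Option ℕ, IsText T L →
    ∀ᶠ m in atTop, (symmDiff (Wset (M (pref T m))) L).Finite ∧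
      (symmDiff (Wset (M (pref T m))) L).ncard ≤ k

/-- `M` behaviourally correctly (BC) learns `C`. -/
def BCLearns (M : List (Option ℕ) → ℕ) (C : Set (Set ℕ)) : Prop :=
  ∀ L ∈ C, ∀ T : ℕ → Option ℕ, IsText T L →
    ∀ᶠ n in atTop, Wset (M (pref T n)) = L

/-- `M` explanatorily (Ex) learns `C`. -/
def ExLearns (M : List (Option ℕ) → ℕ) (C : Set (Set ℕ)) : Prop :=
  ∀ L ∈ C, ∀ T : ℕ → Option ℕ, IsText T L →
    ∃ e n₀, Wset e = L ∧ ∀ n ≥ n₀, M (pref T n) = e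

/-- `M` weakly approximately (WeakApprox) learns `C`: for every text there is
an infinite set `W` such that on every finite variant `V` of `W` almost all
hypotheses agree with the target. -/
def WeakApproxLearns (M : List (Option ℕ) → ℕ) (C : Set (Set ℕ)) : Prop :=
  ∀ L ∈ C, ∀ T : ℕ → Option ℕ, IsText T L →
    ∃ W : Set ℕ, W.Infinite ∧ ∀ V : Set ℕ, (symmDiff V W).Finite →
      ∀ᶠ n in atTop, Wset (M (pref T n)) ∩ V = L ∩ V

/-- `M` approximately (Approx) learns `C`: for every `L ∈ C` there is an
infinite set `W`, good for all texts for `L`. -/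
def ApproxLearns (M : List (Option ℕ) → ℕ) (C : Set (Set ℕ)) : Prop :=
  ∀ L ∈ C, ∃ W : Set ℕ, W.Infinite ∧ ∀ T : ℕ → Option ℕ, IsText T L →
    ∀ V : Set ℕ, (symmDiff V W).Finite →
      ∀ᶠ n in atTop, Wset (M (pref T n)) ∩ V = L ∩ V

/-- Conservativeness for partial learners: on each text for every `L ∈ C`, `M`
outputs exactly one index `e` with `L ⊆ W_e`. -/
def ConsvLearner (M : List (Option ℕ) → ℕ) (C : Set (Set ℕ)) : Prop :=
  ∀ L ∈ C, ∀ T : ℕ → Option ℕ, IsText T L →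
    ∃! e, (∃ n, M (pref T n) = e) ∧ L ⊆ Wset e

/-- Confidence: on every infinite sequence, `M` outputs exactly one index
infinitely often. -/
def Confident (M : List (Option ℕ) → ℕ) : Prop :=
  ∀ T : ℕ → Option ℕ, ∃! e, {n | M (pref T n) = e}.Infinite

/-- The sets ever conjectured by `M` (used to express prudence). -/
def Conjectured (M : List (Option ℕ) → ℕ) : Set (Set ℕ) :=
  {S | ∃ σ : List (Option ℕ), S = Wset (M σ)}

theorem REPred.or {α : Type*} [Primcodable α] {p q : α → Prop} (hp : REPred p) (hq : REPred q) :
    REPred fun a => p a ∨ q a := by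
  obtain ⟨k, hk, H⟩ := Partrec.merge' hp hq
  exact hk.dom_re.of_eq fun a => by simp [(H a).2, Part.assert]

theorem REPred.and {α : Type*} [Primcodable α] {p q : α → Prop} (hp : REPred p) (hq : REPred q) :
    REPred fun a => p a ∧ q a :=
  (Partrec.bind hp (hq.comp Computable.fst).to₂).dom_re.of_eq fun a => by simp [Part.assert]

theorem REPred.comp {α β : Type*} [Primcodable α] [Primcodable β] {p : β → Prop} (hp : REPred p)
    {f : α → β} (hf : Computable f) : REPred fun a => p (f a) :=
  Partrec.comp hp hf

theorem REPred.forall_lt {α : Type*} [Primcodable α] {p : α → ℕ → Prop}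
    (hp : REPred fun x : α × ℕ => p x.1 x.2) {f : α → ℕ} (hf : Computable f) :
    REPred fun a => ∀ k < f a, p a k := by
  have hstep : Partrec₂ fun (a : α) (y : ℕ × Unit) =>
      Part.assert (p a y.1) fun _ => Part.some () :=
    Partrec.comp hp
      (Computable.pair Computable.fst (Computable.fst.comp Computable.snd))
  refine (Partrec.nat_rec hf (Computable.const ()).partrec hstep).dom_re.of_eq fun a => ?_
  induction f a with
  | zero => simp
  | succ n ih =>
    have hsplit : (∀ k < n + 1, p a k) ↔ (∀ k < n, p a k) ∧ p a n := by
      simp only [Nat.lt_succ_iff_lt_or_eq]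
      grind
    rw [hsplit, ← ih]
    simp [Part.assert]

theorem REPred.exists_nat {α : Type*} [Primcodable α] {p : α → ℕ → Prop}
    (hp : REPred fun x : α × ℕ => p x.1 x.2) : REPred fun a => ∃ y, p a y := by
  obtain ⟨c, hc⟩ := Nat.Partrec.Code.exists_code.1 hp
  have hdom : ∀ a y, (c.eval (Encodable.encode (a, y))).Dom ↔ p a y := fun a y => by
    simp [hc, Part.assert]
  have hsearch : Computable₂ fun (a : α) (s : ℕ) =>
      Nat.Partrec.Code.evaln s.unpair.1 c (Encodable.encode (a, s.unpair.2)) :=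
    (Nat.Partrec.Code.primrec_evaln.comp
      (((Primrec.fst.comp (Primrec.unpair.comp Primrec.snd)).pair (Primrec.const c)).pair
        (Primrec.encode.comp
          (Primrec.fst.pair (Primrec.snd.comp (Primrec.unpair.comp Primrec.snd)))))).to_comp
  refine (Partrec.rfindOpt hsearch).dom_re.of_eq fun a => ?_
  rw [Nat.rfindOpt_dom]
  constructor
  · rintro ⟨s, v, hv⟩
    exact ⟨_, (hdom a _).1 (Part.dom_iff_mem.2 ⟨v, Nat.Partrec.Code.evaln_sound hv⟩)⟩
  · rintro ⟨y, hy⟩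
    obtain ⟨v, hv⟩ := Part.dom_iff_mem.1 ((hdom a y).2 hy)
    obtain ⟨s, hs⟩ := Nat.Partrec.Code.evaln_complete.1 hv
    exact ⟨Nat.pair s y, v, by simpa using hs⟩

theorem rePred_mem_Wset : REPred fun x : ℕ × ℕ => x.2 ∈ Wset x.1 :=
  (Nat.Partrec.Code.eval_part.comp ((Computable.ofNat Nat.Partrec.Code).comp Computable.fst)
    Computable.snd).dom_re

/-- A uniformly r.e. family of sets has a computable indexing. -/
theorem REPred.exists_computable_index {α : Type*} [Primcodable α] {p : α → ℕ → Prop}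
    (hp : REPred fun x : α × ℕ => p x.1 x.2) :
    ∃ N : α → ℕ, Computable N ∧ ∀ a, Wset (N a) = {x | p a x} := by
  obtain ⟨c, hc⟩ := Nat.Partrec.Code.exists_code.1 hp
  refine ⟨fun a => Encodable.encode (c.curry (Encodable.encode a)),
    (Primrec.encode.comp (Nat.Partrec.Code.primrec₂_curry.comp (Primrec.const c)
      Primrec.encode)).to_comp, fun a => ?_⟩
  ext x
  have hx : Nat.pair (Encodable.encode a) x = Encodable.encode (a, x) := by simp
  simp only [Wset, phi, PFun.mem_dom, Denumerable.ofNat_encode, Nat.Partrec.Code.eval_curry, hx, hc]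
  simp [Part.assert]

theorem PrimrecRel.list_mem {α : Type*} [Primcodable α] :
    PrimrecRel fun (a : α) (l : List α) => a ∈ l :=
  (Primrec.eq.exists_mem_list.comp Primrec.snd Primrec.fst).of_eq fun x => by simp

theorem PrimrecRel.list_subset {α : Type*} [Primcodable α] :
    PrimrecRel fun l l' : List α => l ⊆ l' :=
  PrimrecRel.list_mem.forall_mem_list

/-- Membership in the set conjectured on `σ` by the weakly approximate learner built from `M`:
the content of `σ`, together with everything above that content if every hypothesis of `M` issued
since the last change of content has an element that is at least the length of `σ`. -/
def Conjecture (M : List (Option ℕ) → ℕ) (σ : List (Option ℕ)) (x : ℕ) : Prop :=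
  some x ∈ σ ∨ (∀ o ∈ σ, Encodable.encode o ≤ x) ∧
    ∀ k < σ.length + 1, ¬ σ ⊆ σ.take k ∨ ∃ y, σ.length + y ∈ Wset (M (σ.take k))

theorem rePred_conjecture {M : List (Option ℕ) → ℕ} (hM : Computable M) :
    REPred fun x : List (Option ℕ) × ℕ => Conjecture M x.1 x.2 := by
  have hmem : REPred fun x : List (Option ℕ) × ℕ => some x.2 ∈ x.1 :=
    (PrimrecRel.list_mem.comp (Primrec.option_some.comp Primrec.snd)
      Primrec.fst).computablePred.to_re
  have hbound : REPred fun x : List (Option ℕ) × ℕ => ∀ o ∈ x.1, Encodable.encode o ≤ x.2 := by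
    have h : PrimrecRel fun (o : Option ℕ) (x : ℕ) => Encodable.encode o ≤ x :=
      Primrec.nat_le.comp (Primrec.encode.comp Primrec.fst) Primrec.snd
    exact (PrimrecPred.computablePred h.forall_mem_list).to_re
  have hsub : REPred fun x : List (Option ℕ) × ℕ => ¬ x.1 ⊆ x.1.take x.2 :=
    (PrimrecRel.list_subset.comp Primrec.fst
      (Primrec.list_take.comp Primrec.snd Primrec.fst)).not.computablePred.to_re
  have hsearch : REPred fun x : List (Option ℕ) × ℕ =>
      ∃ y, x.1.length + y ∈ Wset (M (x.1.take x.2)) := by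
    refine REPred.exists_nat (p := fun (x : List (Option ℕ) × ℕ) y =>
      x.1.length + y ∈ Wset (M (x.1.take x.2))) ?_
    exact rePred_mem_Wset.comp ((hM.comp (Primrec.list_take.to_comp.comp
        (Computable.snd.comp Computable.fst) (Computable.fst.comp Computable.fst))).pair
      (Primrec.nat_add.comp (Primrec.list_length.comp (Primrec.fst.comp Primrec.fst))
        Primrec.snd).to_comp)
  have hall : REPred fun σ : List (Option ℕ) => ∀ k < σ.length + 1,
      ¬ σ ⊆ σ.take k ∨ ∃ y, σ.length + y ∈ Wset (M (σ.take k)) :=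
    REPred.forall_lt (hsub.or hsearch) (Primrec.succ.comp Primrec.list_length).to_comp
  exact hmem.or (hbound.and (hall.comp Computable.fst))

theorem mem_pref {T : ℕ → Option ℕ} {n : ℕ} {o : Option ℕ} : o ∈ pref T n ↔ ∃ i < n, T i = o := by
  simp [pref]

theorem pref_take {T : ℕ → Option ℕ} {n k : ℕ} (h : k ≤ n) : (pref T n).take k = pref T k := by
  simp [pref, ← List.map_take, List.take_range, h]

theorem length_pref (T : ℕ → Option ℕ) (n : ℕ) : (pref T n).length = n := by simp [pref]

theorem conjecture_pref {M : List (Option ℕ) → ℕ} {T : ℕ → Option ℕ} {n x : ℕ} :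
    Conjecture M (pref T n) x ↔ some x ∈ pref T n ∨ (∀ o ∈ pref T n, Encodable.encode o ≤ x) ∧
      ∀ k ≤ n, pref T n ⊆ pref T k → ∃ y, n + y ∈ Wset (M (pref T k)) := by
  simp only [Conjecture, length_pref, Nat.lt_succ_iff, ← imp_iff_not_or]
  refine or_congr_right (and_congr_right fun _ => forall₂_congr fun k hk => ?_)
  rw [pref_take hk]

theorem IsText.mem_iff {T : ℕ → Option ℕ} {L : Set ℕ} (hT : IsText T L) {x : ℕ} :
    x ∈ L ↔ ∃ n, T n = some x := by
  rw [← hT]; rfl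

theorem IsText.mem_of_mem_pref {T : ℕ → Option ℕ} {L : Set ℕ} (hT : IsText T L) {n x : ℕ}
    (h : some x ∈ pref T n) : x ∈ L := by
  obtain ⟨i, -, hi⟩ := mem_pref.1 h
  exact hT.mem_iff.2 ⟨i, hi⟩

theorem eventually_mem_pref (T : ℕ → Option ℕ) (j : ℕ) : ∀ᶠ n in atTop, T j ∈ pref T n := by
  filter_upwards [eventually_gt_atTop j] with n hn
  exact mem_pref.2 ⟨j, hn, rfl⟩

/-- On a text for a finite set, the content of the prefixes stabilizes. -/
theorem IsText.eventually_range_subset_pref {T : ℕ → Option ℕ} {L : Set ℕ} (hT : IsText T L)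
    (hL : L.Finite) : ∀ᶠ n in atTop, ∀ o ∈ Set.range T, o ∈ pref T n := by
  have hfin : (Set.range T).Finite := by
    refine ((hL.image some).insert none).subset ?_
    rintro _ ⟨j, rfl⟩
    rcases hj : T j with - | x
    · simp
    · exact Or.inr ⟨x, hT.mem_iff.2 ⟨j, hj⟩, rfl⟩
  refine (eventually_all_finite hfin).2 ?_
  rintro _ ⟨j, rfl⟩
  exact eventually_mem_pref T j

/-- A text for an infinite set contains arbitrarily large numbers. -/
theorem IsText.exists_lt_encode {T : ℕ → Option ℕ} {L : Set ℕ} (hT : IsText T L)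
    (hL : L.Infinite) (B : ℕ) : ∃ j, B < Encodable.encode (T j) := by
  obtain ⟨x, hx, hBx⟩ := hL.exists_gt B
  obtain ⟨j, hj⟩ := hT.mem_iff.1 hx
  exact ⟨j, by simpa [hj] using hBx.le⟩

theorem finite_iff_of_finite_symmDiff {A B : Set ℕ} (h : (symmDiff A B).Finite) :
    A.Finite ↔ B.Finite := by
  constructor
  · exact fun hA => (hA.union h).subset fun x hx => by
      by_cases hxA : x ∈ A
      · exact Or.inl hxA
      · exact Or.inr (Or.inr ⟨hx, hxA⟩)
  · exact fun hB => (hB.union h).subset fun x hx => by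
      by_cases hxB : x ∈ B
      · exact Or.inl hxB
      · exact Or.inr (Or.inl ⟨hx, hxB⟩)

theorem eventually_conjecture_iff_of_finite {M : List (Option ℕ) → ℕ} {T : ℕ → Option ℕ}
    {L : Set ℕ} (hT : IsText T L) (hL : L.Finite)
    (hM : ∀ᶠ n in atTop, (symmDiff (Wset (M (pref T n))) L).Finite) :
    ∀ᶠ n in atTop, ∀ x, Conjecture M (pref T n) x ↔ x ∈ L := by
  have hcontent := hT.eventually_range_subset_pref hL
  obtain ⟨k, hk, hkM⟩ := (hcontent.and hM).exists
  obtain ⟨B, hB⟩ := ((finite_iff_of_finite_symmDiff hkM).2 hL).bddAbove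
  filter_upwards [hcontent, eventually_ge_atTop k, eventually_gt_atTop B] with n hn hkn hBn x
  rw [conjecture_pref]
  constructor
  · rintro (hx | ⟨-, hx⟩)
    · exact hT.mem_of_mem_pref hx
    · obtain ⟨y, hy⟩ := hx k hkn fun o ho => by
        obtain ⟨i, -, rfl⟩ := mem_pref.1 ho
        exact hk _ ⟨i, rfl⟩
      have := hB hy
      omega
  · intro hx
    obtain ⟨j, hj⟩ := hT.mem_iff.1 hx
    exact Or.inl (hn _ ⟨j, hj⟩)

theorem eventually_conjecture_iff_of_infinite {M : List (Option ℕ) → ℕ} {T : ℕ → Option ℕ}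
    {L : Set ℕ} (hT : IsText T L) (hL : L.Infinite)
    (hM : ∀ᶠ n in atTop, (symmDiff (Wset (M (pref T n))) L).Finite) :
    ∀ᶠ n in atTop, ∀ x, Conjecture M (pref T n) x ↔
      some x ∈ pref T n ∨ ∀ o ∈ pref T n, Encodable.encode o ≤ x := by
  obtain ⟨m, hm⟩ := eventually_atTop.1 hM
  obtain ⟨B, hB⟩ := ((Set.finite_lt_nat m).image fun i => Encodable.encode (T i)).bddAbove
  obtain ⟨j, hj⟩ := hT.exists_lt_encode hL B
  filter_upwards [eventually_mem_pref T j] with n hn x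
  rw [conjecture_pref]
  refine or_congr_right (and_iff_left fun k _ hk => ?_)
  have hmk : m ≤ k := by
    obtain ⟨i, hik, hi⟩ := mem_pref.1 (hk hn)
    by_contra! hlt
    have hle : Encodable.encode (T i) ≤ B := hB ⟨i, show i < m by omega, rfl⟩
    rw [hi] at hle
    omega
  have hinf : (Wset (M (pref T k))).Infinite := fun hfin =>
    hL ((finite_iff_of_finite_symmDiff (hm k hmk)).1 hfin)
  obtain ⟨z, hz, hnz⟩ := hinf.exists_gt n
  exact ⟨z - n, by rwa [Nat.add_sub_cancel' hnz.le]⟩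

/-- The numbers that are larger than everything preceding them in `T`. -/
def recordSet (T : ℕ → Option ℕ) : Set ℕ :=
  {x | ∃ j, T j = some x ∧ ∀ i < j, Encodable.encode (T i) ≤ x}

theorem IsText.infinite_recordSet {T : ℕ → Option ℕ} {L : Set ℕ} (hT : IsText T L)
    (hL : L.Infinite) : (recordSet T).Infinite := by
  refine Set.infinite_of_forall_exists_gt fun B => ?_
  have hex := hT.exists_lt_encode hL (B + 1)
  have hspec := Nat.find_spec hex
  rcases hj : T (Nat.find hex) with - | x
  · simp [hj] at hspec
  · rw [hj, Encodable.encode_some] at hspec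
    have hBx : B + 1 < x + 1 := hspec
    refine ⟨x, ⟨Nat.find hex, hj, fun i hi => ?_⟩, by omega⟩
    have := Nat.find_min hex hi
    omega

theorem mem_pref_or_forall_le_of_mem_recordSet {T : ℕ → Option ℕ} {x : ℕ}
    (hx : x ∈ recordSet T) (n : ℕ) :
    some x ∈ pref T n ∨ ∀ o ∈ pref T n, Encodable.encode o ≤ x := by
  obtain ⟨j, hj, hlt⟩ := hx
  rcases lt_or_ge j n with hjn | hnj
  · exact Or.inl (mem_pref.2 ⟨j, hjn, hj⟩)
  · refine Or.inr fun o ho => ?_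
    obtain ⟨i, hi, rfl⟩ := mem_pref.1 ho
    exact hlt i (hi.trans_le hnj)

theorem IsText.eventually_mem_pref_or_forall_le_iff {T : ℕ → Option ℕ} {L : Set ℕ}
    (hT : IsText T L) (hL : L.Infinite) (x : ℕ) : ∀ᶠ n in atTop,
      ((some x ∈ pref T n ∨ ∀ o ∈ pref T n, Encodable.encode o ≤ x) ↔ x ∈ L) := by
  obtain ⟨j, hj⟩ := hT.exists_lt_encode hL x
  by_cases hx : x ∈ L
  · obtain ⟨i, hi⟩ := hT.mem_iff.1 hx
    filter_upwards [eventually_mem_pref T i] with n hn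
    exact iff_of_true (Or.inl (hi ▸ hn)) hx
  · filter_upwards [eventually_mem_pref T j] with n hn
    refine iff_of_false ?_ hx
    rintro (h | h)
    · exact hx (hT.mem_of_mem_pref h)
    · exact (h _ hn).not_gt hj

/-- If a class of r.e. sets is BC* learnable then it is weakly approximately
learnable. -/
theorem stmt3 (C : Set (Set ℕ)) (hC : ∀ L ∈ C, ∃ e, Wset e = L)
    (h : ∃ M : List (Option ℕ) → ℕ, Computable M ∧ BCstarLearns M C) :
    ∃ N : List (Option ℕ) → ℕ, Computable N ∧ WeakApproxLearns N C := by
  obtain ⟨M, hMc, hM⟩ := h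
  obtain ⟨N, hNc, hN⟩ := (rePred_conjecture hMc).exists_computable_index
  refine ⟨N, hNc, fun L hLC T hT => ?_⟩
  have hML := hM L hLC T hT
  by_cases hL : L.Finite
  · refine ⟨Set.univ, Set.infinite_univ, fun V _ => ?_⟩
    filter_upwards [eventually_conjecture_iff_of_finite hT hL hML] with n hn
    ext x
    rw [hN, Set.mem_inter_iff, Set.mem_inter_iff, Set.mem_ofPred_eq, hn x]
  · refine ⟨recordSet T, hT.infinite_recordSet hL, fun V hV => ?_⟩
    have hdiff : (V \ recordSet T).Finite := hV.subset fun x hx => Or.inl hx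
    filter_upwards [eventually_conjecture_iff_of_infinite hT hL hML,
      (eventually_all_finite hdiff).2 fun x _ =>
        hT.eventually_mem_pref_or_forall_le_iff hL x] with n hn hnV
    ext x
    rw [hN, Set.mem_inter_iff, Set.mem_inter_iff, Set.mem_ofPred_eq, hn x]
    refine and_congr_left fun hxV => ?_
    by_cases hxW : x ∈ recordSet T
    · refine iff_of_true (mem_pref_or_forall_le_of_mem_recordSet hxW n) ?_
      obtain ⟨j, hj, -⟩ := hxW
      exact hT.mem_iff.2 ⟨j, hj⟩
    · exact hnV x ⟨hxV, hxW⟩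
end

section
/- For every countable class 𝒲 of infinite subsets of ℕ, the class of all cofinite subsets of ℕ is not WeakApprox learnable via 𝒲: there is no learner M such that for every cofinite L ⊆ ℕ and every text T for L, there exists W ∈ 𝒲 such that M weakly approximately learns L via W on T. -/
open Filter

/-- An increasing chain of finite sequences of unbounded length has a limit sequence. -/
theorem exists_limit_of_prefix_chain (s : ℕ → List (Option ℕ))
    (hs : ∀ i, s i <+: s (i + 1)) (hlen : ∀ i, i ≤ (s i).length) :
    ∃ T : ℕ → Option ℕ, ∀ i, pref T (s i).length = s i := by
  have hmono : ∀ i j, i ≤ j → s i <+: s j := by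
    intro i j hij
    induction j, hij using Nat.le_induction with
    | base => exact List.prefix_refl _
    | succ j _ ih => exact ih.trans (hs j)
  refine ⟨fun n => (s (n + 1))[n]'(hlen (n + 1)), fun i => ?_⟩
  refine List.ext_getElem (by simp [pref]) fun n h₁ h₂ => ?_
  simp only [pref, List.getElem_map, List.getElem_range]
  rcases le_total i (n + 1) with h | h
  · exact ((hmono _ _ h).getElem h₂).symm
  · exact (hmono _ _ h).getElem _

/-- Every finite sequence with content in `L` is an initial segment of a text for `L`. -/
theorem exists_text_extending (σ : List (Option ℕ)) (L : Set ℕ)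
    (hσ : ∀ y, some y ∈ σ → y ∈ L) :
    ∃ T : ℕ → Option ℕ, IsText T L ∧ ∀ n, σ.length ≤ n → σ <+: pref T n := by
  classical
  let T : ℕ → Option ℕ := fun n =>
    (σ[n]?).getD (if n - σ.length ∈ L then some (n - σ.length) else none)
  refine ⟨T, ?_, fun n hn => ?_⟩
  · ext y
    constructor
    · rintro ⟨n, hn⟩
      by_cases h : n < σ.length
      · refine hσ y (List.mem_iff_getElem.2 ⟨n, h, ?_⟩)
        simpa [T, h] using hn
      · have hn' : n - σ.length ∈ L ∧ n - σ.length = y := by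
          simpa [T, List.getElem?_eq_none (not_lt.1 h)] using hn
        exact hn'.2 ▸ hn'.1
    · intro hy
      exact ⟨σ.length + y, by simp [T, hy]⟩
  · rw [List.prefix_iff_getElem]
    refine ⟨by simpa [pref] using hn, fun k hk => ?_⟩
    simp [pref, T, hk]

/-- If the hypotheses on every text for `ℕ` eventually contain one of countably many sets, then
one of these sets is contained in the hypotheses on all extensions of some finite sequence. -/
theorem exists_locking_sequence (H : List (Option ℕ) → Set ℕ) (W : ℕ → Set ℕ)
    (h : ∀ T : ℕ → Option ℕ, IsText T Set.univ →
      ∃ k, ∀ᶠ n in atTop, W k ⊆ H (pref T n)) :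
    ∃ σ k, ∀ τ, σ <+: τ → W k ⊆ H τ := by
  by_contra! hbad
  choose g hg hgbad using hbad
  obtain ⟨s, hs⟩ : ∃ s : ℕ → List (Option ℕ),
      ∀ i, s (i + 1) = g (s i ++ [some i]) i.unpair.1 :=
    ⟨fun i => Nat.rec [] (fun i σ => g (σ ++ [some i]) i.unpair.1) i, fun _ => rfl⟩
  have hstep : ∀ i, s i ++ [some i] <+: s (i + 1) := fun i => hs i ▸ hg _ _
  have hlen : ∀ i, i ≤ (s i).length := by
    intro i
    induction i with
    | zero => exact Nat.zero_le _
    | succ i ih =>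
      have := (hstep i).length_le
      simp only [List.length_append, List.length_singleton] at this
      omega
  obtain ⟨T, hT⟩ := exists_limit_of_prefix_chain s
    (fun i => (List.prefix_append _ _).trans (hstep i)) hlen
  have htext : IsText T Set.univ := by
    refine Set.eq_univ_of_forall fun i => ?_
    have hi : some i ∈ pref T (s (i + 1)).length := by
      rw [hT]
      exact (hstep i).subset (by simp)
    obtain ⟨n, -, hn⟩ := List.mem_map.1 hi
    exact ⟨n, hn⟩
  obtain ⟨k, hk⟩ := h T htext
  obtain ⟨N, hN⟩ := eventually_atTop.1 hk
  have hle : N ≤ (s (Nat.pair k N + 1)).length :=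
    (Nat.right_le_pair k N).trans ((Nat.le_succ _).trans (hlen _))
  have hsub := hN _ hle
  rw [hT, hs, Nat.unpair_pair] at hsub
  exact hgbad _ _ hsub

/-- For every countable class 𝒲 of infinite sets, the class of all cofinite
sets is not weakly approximately learnable via 𝒲. -/
theorem stmt7 (𝒲 : Set (Set ℕ)) (hcount : 𝒲.Countable)
    (hinf : ∀ W ∈ 𝒲, W.Infinite) :
    ¬ ∃ M : List (Option ℕ) → ℕ, Computable M ∧
      ∀ L : Set ℕ, Lᶜ.Finite → ∀ T : ℕ → Option ℕ, IsText T L →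
        ∃ W ∈ 𝒲, ∀ V : Set ℕ, (symmDiff V W).Finite →
          ∀ᶠ n in atTop, Wset (M (pref T n)) ∩ V = L ∩ V := by
  rintro ⟨M, -, hM⟩
  have hne : 𝒲.Nonempty := by
    obtain ⟨T, hT, -⟩ := exists_text_extending [] Set.univ (by simp)
    obtain ⟨W, hW, -⟩ := hM Set.univ (by simp) T hT
    exact ⟨W, hW⟩
  obtain ⟨f, rfl⟩ := hcount.exists_eq_range hne
  obtain ⟨σ, k, hlock⟩ := exists_locking_sequence (fun τ => Wset (M τ)) f (by
    intro T hT
    obtain ⟨_, ⟨k, rfl⟩, hk⟩ := hM Set.univ (by simp) T hT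
    refine ⟨k, (hk (f k) (by simp)).mono fun n hn => ?_⟩
    rw [Set.univ_inter] at hn
    exact Set.inter_eq_right.1 hn)
  have hfin : {x : ℕ | some x ∈ σ}.Finite :=
    σ.finite_toSet.preimage (Option.some_injective ℕ).injOn
  obtain ⟨x, hxW, hxσ⟩ := (hinf (f k) ⟨k, rfl⟩).exists_notMem_finite hfin
  obtain ⟨T, hT, hpre⟩ := exists_text_extending σ {x}ᶜ (by
    rintro y hy rfl
    exact hxσ hy)
  obtain ⟨W, -, hW⟩ := hM {x}ᶜ (by simp) T hT
  have hV : (symmDiff (insert x W) W).Finite := by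
    refine (Set.finite_singleton x).subset ?_
    rintro y (⟨rfl | hy, hy'⟩ | ⟨hy, hy'⟩)
    · rfl
    · exact absurd hy hy'
    · exact absurd (Set.mem_insert_of_mem x hy) hy'
  obtain ⟨n, hn, hσn⟩ := ((hW _ hV).and (eventually_ge_atTop σ.length)).exists
  have hx : x ∈ Wset (M (pref T n)) ∩ insert x W :=
    ⟨hlock _ (hpre n hσn) hxW, Set.mem_insert x W⟩
  rw [hn] at hx
  exact hx.1 rfl
end
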